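/- Let G be a finite p-solvable minimal non-p-supersolvable group. Then the p-supersolvable residual G^{𝔘_p} is a p-group of exponent p if p is odd, and of exponent at most 4 if p = 2; moreover G^{𝔘_p}/Φ(G^{𝔘_p}) is a chief factor of G. -/

import Mathlib

open Subgroup Pointwise

/-- `A < B` is a chief factor of `G`. -/
def IsChiefFactor (G : Type*) [Group G] (A B : Subgroup G) : Prop :=
  A.Normal ∧ B.Normal ∧ A < B ∧
    ∀ N : Subgroup G, N.Normal → A ≤ N → N ≤ B → N = A ∨ N = B

/-- The order of the factor group `B/A`. -/
noncomputable def factorCard {G : Type*} [Group G] (A B : Subgroup G) : ℕ :=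
  Nat.card B / Nat.card A

/-- A finite group is `p`-solvable if every chief factor is a `p`-group or a `p'`-group. -/
def IsPSolvable (p : ℕ) (G : Type*) [Group G] : Prop :=
  ∀ A B : Subgroup G, IsChiefFactor G A B →
    (∃ n : ℕ, factorCard A B = p ^ n) ∨ ¬ p ∣ factorCard A B

/-- A finite group is `p`-supersolvable if it is `p`-solvable and every `p`-chief factor
has order `p`. -/
def IsPSupersolvable (p : ℕ) (G : Type*) [Group G] : Prop :=
  IsPSolvable p G ∧ ∀ A B : Subgroup G, IsChiefFactor G A B →
    p ∣ factorCard A B → factorCard A B = p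

/-- A finite group is `p`-nilpotent if it has a normal Hall `p'`-subgroup. -/
def IsPNilpotent (p : ℕ) (G : Type*) [Group G] : Prop :=
  ∃ H : Subgroup G, H.Normal ∧ ¬ p ∣ Nat.card H ∧ ∃ n : ℕ, H.index = p ^ n

/-- The quotient `G ⧸ N` is `p`-supersolvable (for `N` normal). -/
def QuotientIsPSupersolvable (p : ℕ) {G : Type*} [Group G] (N : Subgroup G) : Prop :=
  ∀ [N.Normal], IsPSupersolvable p (G ⧸ N)

/-- `R` is the `p`-supersolvable residual of `G`: the smallest normal subgroup with
`p`-supersolvable quotient. -/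
def IsPSupersolvableResidual (p : ℕ) {G : Type*} [Group G] (R : Subgroup G) : Prop :=
  R.Normal ∧ QuotientIsPSupersolvable p R ∧
    ∀ N : Subgroup G, N.Normal → QuotientIsPSupersolvable p N → R ≤ N

/-- the center `Z(K)` of a subgroup `K`, as a subgroup of the ambient group. -/
def centerOf {G : Type*} [Group G] (K : Subgroup G) : Subgroup G :=
  Subgroup.centralizer (K : Set G) ⊓ K

/-- `H` is c-embedded in `G` with respect to `K`: there is `B ≤ G` with `G = HB` and
`H ∩ B ≤ Z(K)`. -/
def IsCEmbedded {G : Type*} [Group G] (H K : Subgroup G) : Prop :=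
  ∃ B : Subgroup G, (∀ g : G, ∃ h ∈ H, ∃ b ∈ B, g = h * b) ∧ H ⊓ B ≤ centerOf K

/-- A group is quaternion-free if no section is isomorphic to the quaternion group `Q₈`. -/
def QuaternionFree (G : Type*) [Group G] : Prop :=
  ∀ (H : Subgroup G) (N : Subgroup H) [N.Normal], IsEmpty ((H ⧸ N) ≃* QuaternionGroup 2)

/-- the conjugate `P^x = x⁻¹ P x`. -/
def conjSub {G : Type*} [Group G] (P : Subgroup G) (x : G) : Subgroup G :=
  (MulAut.conj x⁻¹) • P

section ChiefFactors

variable {G : Type*} [Group G]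

lemma factorCard_eq_relIndex [Finite G] {A B : Subgroup G} (h : A ≤ B) :
    factorCard A B = A.relIndex B := by
  have h1 := relIndex_mul_relIndex ⊥ A B bot_le h
  rw [relIndex_bot_left, relIndex_bot_left] at h1
  rw [factorCard, ← h1, Nat.mul_div_cancel_left _ Nat.card_pos]

/-- All chief factors above `N` whose order is divisible by `p` have order `p`. -/
def GoodAbove (p : ℕ) (N : Subgroup G) : Prop :=
  ∀ A B : Subgroup G, IsChiefFactor G A B → N ≤ A → p ∣ A.relIndex B → A.relIndex B = p

lemma isPSupersolvable_iff [Finite G] {p : ℕ} :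
    IsPSupersolvable p G ↔ GoodAbove p (⊥ : Subgroup G) := by
  constructor
  · intro h A B hAB _ hd
    have := h.2 A B hAB
    rw [factorCard_eq_relIndex hAB.2.2.1.le] at this
    exact this hd
  · intro h
    refine ⟨fun A B hAB => ?_, fun A B hAB => ?_⟩
    · rw [factorCard_eq_relIndex hAB.2.2.1.le]
      by_cases hd : p ∣ A.relIndex B
      · exact Or.inl ⟨1, by rw [h A B hAB bot_le hd, pow_one]⟩
      · exact Or.inr hd
    · rw [factorCard_eq_relIndex hAB.2.2.1.le]
      exact h A B hAB bot_le

lemma relIndex_comap_comap {X : Type*} [Group X] {f : G →* X} (hf : Function.Surjective f)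
    (A B : Subgroup X) : (A.comap f).relIndex (B.comap f) = A.relIndex B := by
  rw [relIndex_comap, map_comap_eq_self_of_surjective hf]

lemma IsChiefFactor.comap {X : Type*} [Group X] {f : G →* X} (hf : Function.Surjective f)
    {A B : Subgroup X} (h : IsChiefFactor X A B) :
    IsChiefFactor G (A.comap f) (B.comap f) := by
  obtain ⟨hA, hB, hlt, hc⟩ := h
  refine ⟨hA.comap f, hB.comap f, (comap_lt_comap_of_surjective hf).2 hlt, ?_⟩
  intro N hN hAN hNB
  have hk : f.ker ≤ N := le_trans (by
    intro x hx; rw [mem_comap, (MonoidHom.mem_ker).1 hx]; exact A.one_mem) hAN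
  have hNN : (N.map f).comap f = N := comap_map_eq_self hk
  have h1 : A ≤ N.map f := by rwa [← comap_le_comap_of_surjective hf, hNN]
  have h2 : N.map f ≤ B := by rwa [← comap_le_comap_of_surjective hf, hNN]
  rcases hc (N.map f) (hN.map f hf) h1 h2 with h | h
  · left; rw [← hNN, h]
  · right; rw [← hNN, h]

lemma IsChiefFactor.map {X : Type*} [Group X] {f : G →* X} (hf : Function.Surjective f)
    {A B : Subgroup G} (hk : f.ker ≤ A) (h : IsChiefFactor G A B) :
    IsChiefFactor X (A.map f) (B.map f) := by
  obtain ⟨hA, hB, hlt, hc⟩ := h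
  have hAA : (A.map f).comap f = A := comap_map_eq_self hk
  have hBB : (B.map f).comap f = B := comap_map_eq_self (hk.trans hlt.le)
  refine ⟨hA.map f hf, hB.map f hf, ?_, ?_⟩
  · rw [← comap_lt_comap_of_surjective hf, hAA, hBB]; exact hlt
  intro N hN hAN hNB
  rw [← comap_le_comap_of_surjective hf, hAA] at hAN
  rw [← comap_le_comap_of_surjective hf, hBB] at hNB
  rcases hc (N.comap f) (hN.comap f) hAN hNB with h | h
  · left; rw [← h, map_comap_eq_self_of_surjective hf]
  · right; rw [← h, map_comap_eq_self_of_surjective hf]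

lemma isPSupersolvable_iff_of_surjective {X : Type*} [Group X] [Finite X] {p : ℕ} {f : G →* X}
    (hf : Function.Surjective f) : IsPSupersolvable p X ↔ GoodAbove p f.ker := by
  rw [isPSupersolvable_iff]
  constructor
  · intro h A B hAB hk
    have hAA : (A.map f).comap f = A := comap_map_eq_self hk
    have hBB : (B.map f).comap f = B := comap_map_eq_self (hk.trans hAB.2.2.1.le)
    have := h _ _ (hAB.map hf hk) bot_le
    rwa [← relIndex_comap_comap hf, hAA, hBB] at this
  · intro h A B hAB _
    have := h _ _ (hAB.comap hf) (by
      intro x hx; rw [mem_comap, (MonoidHom.mem_ker).1 hx]; exact A.one_mem)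
    rwa [relIndex_comap_comap hf] at this

lemma GoodAbove.mono {p : ℕ} {N K : Subgroup G} (h : GoodAbove p N) (hNK : N ≤ K) :
    GoodAbove p K := fun A B hAB hKA => h A B hAB (hNK.trans hKA)

lemma isPSupersolvable_quotient_iff [Finite G] {p : ℕ} {N : Subgroup G} [N.Normal] :
    IsPSupersolvable p (G ⧸ N) ↔ GoodAbove p N := by
  rw [isPSupersolvable_iff_of_surjective (QuotientGroup.mk'_surjective N), QuotientGroup.ker_mk']

lemma IsPSupersolvable.of_surjective {X : Type*} [Group X] [Finite G] [Finite X] {p : ℕ}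
    {f : G →* X} (hf : Function.Surjective f) (h : IsPSupersolvable p G) :
    IsPSupersolvable p X :=
  (isPSupersolvable_iff_of_surjective hf).2 ((isPSupersolvable_iff.1 h).mono bot_le)

/-- A chief factor is seen either above or below a given normal subgroup. -/
lemma IsChiefFactor.sup_or_inf {A B : Subgroup G} (h : IsChiefFactor G A B) (N : Subgroup G)
    [N.Normal] :
    (IsChiefFactor G (A ⊔ N) (B ⊔ N) ∧ (A ⊔ N).relIndex (B ⊔ N) = A.relIndex B) ∨
    (IsChiefFactor G (A ⊓ N) (B ⊓ N) ∧ (A ⊓ N).relIndex (B ⊓ N) = A.relIndex B) := by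
  obtain ⟨hA, hB, hlt, hc⟩ := h
  have hle := hlt.le
  have hmod : B ⊓ (A ⊔ N) = A ⊔ (B ⊓ N) := by
    apply le_antisymm _ (sup_le (le_inf hle le_sup_left) (inf_le_inf_left _ le_sup_right))
    rintro x ⟨hxB, hx⟩
    obtain ⟨a, ha, n, hn, rfl⟩ := (mem_sup_of_normal_right).1 hx
    exact mul_mem (mem_sup_left ha) (mem_sup_right ⟨(mul_mem_cancel_left (hle ha)).1 hxB, hn⟩)
  rcases hc (B ⊓ (A ⊔ N)) inferInstance (le_inf hle le_sup_left) inf_le_left with h | h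
  · left
    have hBN : B ⊔ (A ⊔ N) = B ⊔ N := by rw [← sup_assoc, sup_eq_left.2 hle]
    have hi : (A ⊔ N).relIndex (B ⊔ N) = A.relIndex B := by
      rw [← hBN, relIndex_sup_right, ← inf_relIndex_right, inf_comm, h]
    refine ⟨⟨inferInstance, inferInstance, ?_, ?_⟩, hi⟩
    · refine lt_of_le_of_ne (sup_le_sup_right hle _) fun he => ?_
      rw [he, relIndex_self] at hi
      exact hlt.not_ge (relIndex_eq_one.1 hi.symm)
    · intro T hT hAT hTB
      have hNT : N ≤ T := le_sup_right.trans hAT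
      have hTT : T = (T ⊓ B) ⊔ N := by
        apply le_antisymm _ (sup_le inf_le_left hNT)
        intro x hx
        obtain ⟨b, hb, n, hn, rfl⟩ := (mem_sup_of_normal_right).1 (hTB hx)
        exact mul_mem (mem_sup_left ⟨(mul_mem_cancel_right (hNT hn)).1 hx, hb⟩)
          (mem_sup_right hn)
      rcases hc (T ⊓ B) inferInstance (le_inf (le_sup_left.trans hAT) hle) inf_le_right with h' | h'
      · left; rw [hTT, h']
      · right; rw [hTT, h']
  · right
    rw [hmod] at h
    have hi : (A ⊓ N).relIndex (B ⊓ N) = A.relIndex B := by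
      conv_rhs => rw [← h, relIndex_sup_left, ← inf_relIndex_right]
      rw [← inf_assoc, inf_eq_left.2 hle]
    refine ⟨⟨inferInstance, inferInstance, ?_, ?_⟩, hi⟩
    · refine lt_of_le_of_ne (inf_le_inf_right _ hle) fun he => ?_
      rw [he, relIndex_self] at hi
      exact hlt.not_ge (relIndex_eq_one.1 hi.symm)
    · intro T hT hAT hTB
      have hTT : T = (A ⊔ T) ⊓ N := by
        apply le_antisymm (le_inf le_sup_right (hTB.trans inf_le_right))
        rintro x ⟨hx, hxN⟩
        obtain ⟨a, ha, t, ht, rfl⟩ := (mem_sup_of_normal_right).1 hx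
        have htN : t ∈ N := (hTB.trans inf_le_right) ht
        exact mul_mem (hAT ⟨ha, (mul_mem_cancel_right htN).1 hxN⟩) ht
      rcases hc (A ⊔ T) inferInstance le_sup_left (sup_le hle (hTB.trans inf_le_left)) with h' | h'
      · left; rw [hTT, h']
      · right; rw [hTT, h']

lemma GoodAbove.extend {p : ℕ} {K N : Subgroup G} [N.Normal] (hN : GoodAbove p N)
    (hK : K ≤ N)
    (h : ∀ A B : Subgroup G, IsChiefFactor G A B → K ≤ A → B ≤ N → p ∣ A.relIndex B →
      A.relIndex B = p) : GoodAbove p K := by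
  intro A B hAB hKA
  rcases hAB.sup_or_inf N with ⟨h1, h2⟩ | ⟨h1, h2⟩
  · rw [← h2]; exact hN _ _ h1 le_sup_right
  · rw [← h2]; exact h _ _ h1 (le_inf hKA hK) inf_le_right

lemma exists_isChiefFactor_le [Finite G] {T R : Subgroup G} [hR : R.Normal] (hT : T.Normal)
    (hlt : T < R) : ∃ D, T ≤ D ∧ IsChiefFactor G D R := by
  obtain ⟨D, hTD, hD⟩ := (Set.toFinite {D : Subgroup G | D.Normal ∧ D < R}).exists_le_maximal
    (a := T) ⟨hT, hlt⟩
  refine ⟨D, hTD, hD.1.1, hR, hD.1.2, fun N hN hDN hNR => ?_⟩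
  by_contra! hne
  exact hne.1 (le_antisymm (hD.2 ⟨hN, lt_of_le_of_ne hNR hne.2⟩ hDN) hDN)

lemma exists_isChiefFactor_bot [Finite G] [Nontrivial G] :
    ∃ N : Subgroup G, IsChiefFactor G ⊥ N := by
  obtain ⟨N, -, hN⟩ := (Set.toFinite {D : Subgroup G | D.Normal ∧ ⊥ < D}).exists_le_minimal
    (a := ⊤) ⟨inferInstance, bot_lt_top⟩
  refine ⟨N, inferInstance, hN.1.1, hN.1.2, fun T hT _ hTN => ?_⟩
  rcases eq_or_ne T ⊥ with h | h
  · exact Or.inl h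
  · exact Or.inr (le_antisymm hTN (hN.2 ⟨hT, bot_lt_iff_ne_bot.2 h⟩ hTN))

end ChiefFactors

section Verbal

open scoped commutatorElement

/-- The subgroup generated by all commutators and all `(p - 1)`-th powers. -/
def verbal (p : ℕ) (X : Type*) [Group X] : Subgroup X :=
  closure {x | (∃ a b : X, ⁅a, b⁆ = x) ∨ ∃ a : X, a ^ (p - 1) = x}

variable {X Y : Type*} [Group X] [Group Y] {p : ℕ}

lemma map_verbal {f : X →* Y} (hf : Function.Surjective f) :
    (verbal p X).map f = verbal p Y := by
  rw [verbal, MonoidHom.map_closure, verbal]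
  congr 1
  ext y
  constructor
  · rintro ⟨x, ⟨a, b, rfl⟩ | ⟨a, rfl⟩, rfl⟩
    · exact Or.inl ⟨f a, f b, (map_commutatorElement f a b).symm⟩
    · exact Or.inr ⟨f a, (map_pow f a _).symm⟩
  · rintro (⟨a, b, rfl⟩ | ⟨a, rfl⟩)
    · obtain ⟨a, rfl⟩ := hf a
      obtain ⟨b, rfl⟩ := hf b
      exact ⟨⁅a, b⁆, Or.inl ⟨a, b, rfl⟩, map_commutatorElement f a b⟩
    · obtain ⟨a, rfl⟩ := hf a
      exact ⟨a ^ (p - 1), Or.inr ⟨a, rfl⟩, map_pow f a _⟩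

lemma map_mem_verbal {f : X →* Y} (hf : Function.Surjective f) {x : X} (hx : x ∈ verbal p X) :
    f x ∈ verbal p Y := by
  rw [← map_verbal hf]
  exact mem_map_of_mem f hx

instance verbal_normal : (verbal p X).Normal :=
  ⟨fun _ hn g => map_mem_verbal (f := (MulAut.conj g).toMonoidHom) (MulAut.conj g).surjective hn⟩

/-- The verbal subgroup centralizes every normal subgroup of order `p`. -/
lemma verbal_commute_of_card_eq (hp : p.Prime) {N : Subgroup X} [N.Normal]
    (hN : Nat.card N = p) {u : X} (hu : u ∈ verbal p X) {v : X} (hv : v ∈ N) :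
    u * v = v * u := by
  have : Fact p.Prime := ⟨hp⟩
  have : IsCyclic N := isCyclic_of_prime_card hN
  have : Finite N := Nat.finite_of_card_ne_zero (by rw [hN]; exact hp.ne_zero)
  have hcomm : ∀ a b : MulAut N, a * b = b * a := fun a b =>
    (IsCyclic.mulAutMulEquiv N).injective (by rw [map_mul, map_mul, mul_comm])
  have hle : verbal p X ≤ (MulAut.conjNormal : X →* MulAut N).ker := by
    rw [verbal, closure_le]
    rintro x (⟨a, b, rfl⟩ | ⟨a, rfl⟩)
    · rw [SetLike.mem_coe, MonoidHom.mem_ker, map_commutatorElement,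
        commutatorElement_eq_one_iff_mul_comm]
      exact hcomm _ _
    · rw [SetLike.mem_coe, MonoidHom.mem_ker, map_pow]
      have hc : Nat.card (MulAut N) = p - 1 := by
        rw [IsCyclic.card_mulAut, hN, Nat.totient_prime hp]
      rw [← hc, pow_card_eq_one']
  have h1 := congrArg (fun φ : MulAut N => ((φ ⟨v, hv⟩ : N) : X)) (MonoidHom.mem_ker.1 (hle hu))
  simp only [MulAut.conjNormal_apply, MulAut.one_apply] at h1
  rw [← mul_inv_eq_iff_eq_mul, h1]

/-- A central subgroup of order coprime to its index has a normal complement consisting of the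
elements killed by the index. -/
lemma exists_subgroup_mem_iff_pow_index_eq_one [Finite X] {Z : Subgroup X} (hZ : Z ≤ center X)
    (hc : Nat.Coprime (Nat.card Z) Z.index) :
    ∃ H : Subgroup X, Nat.card H = Z.index ∧ ∀ x, x ∈ H ↔ x ^ Z.index = 1 := by
  have : Z.Normal := ⟨fun n hn g => by
    rwa [mem_center_iff.1 (hZ hn) g, mul_inv_cancel_right]⟩
  obtain ⟨H, hH⟩ := exists_right_complement'_of_coprime hc
  have hcard : Nat.card H = Z.index := hH.symm.index_eq_card.symm
  refine ⟨H, hcard, fun x => ⟨fun hx => ?_, fun hx => ?_⟩⟩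
  · rw [← hcard]
    exact congrArg Subtype.val (pow_card_eq_one' (x := (⟨x, hx⟩ : H)))
  · obtain ⟨⟨⟨z, hz⟩, ⟨h, hh⟩⟩, hzh : z * h = x⟩ := hH.2 x
    have h1 : h ^ Z.index = 1 := by
      rw [← hcard]
      exact congrArg Subtype.val (pow_card_eq_one' (x := (⟨h, hh⟩ : H)))
    have h2 : z ^ Nat.card Z = 1 :=
      congrArg Subtype.val (pow_card_eq_one' (x := (⟨z, hz⟩ : Z)))
    have hcomm : Commute z h := (mem_center_iff.1 (hZ hz) h).symm
    rw [← hzh, hcomm.mul_pow, h1, mul_one] at hx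
    have hz1 : z = 1 := (pow_eq_one_iff_of_coprime hc).1 ⟨h2, hx⟩
    rw [← hzh, hz1, one_mul]
    exact hh

/-- In a `p`-supersolvable group the verbal subgroup has a normal `p`-complement. -/
lemma IsPSupersolvable.exists_normal_complement_verbal (hp : p.Prime) (X : Type*) [Group X]
    [Finite X] (h : IsPSupersolvable p X) :
    ∃ Q : Subgroup X, Q.Normal ∧ Q ≤ verbal p X ∧ Nat.Coprime p (Nat.card Q) ∧
      ∀ u ∈ verbal p X, ∃ k, u ^ p ^ k ∈ Q := by
  induction hn : Nat.card X using Nat.strong_induction_on generalizing X with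
  | _ n ih =>
  rcases subsingleton_or_nontrivial X with hX | hX
  · exact ⟨⊥, inferInstance, bot_le, by simp, fun u _ => ⟨0, by simp [Subsingleton.elim u 1]⟩⟩
  obtain ⟨N, hN⟩ := exists_isChiefFactor_bot (G := X)
  have hNn : N.Normal := hN.2.1
  have hcardX := N.card_eq_card_quotient_mul_card_subgroup
  have hNcard : 1 < Nat.card N := N.one_lt_card_iff_ne_bot.2 hN.2.2.1.ne'
  obtain ⟨Q', hQn, -, hQc, hQu⟩ := ih (Nat.card (X ⧸ N))
    (by rw [← hn, hcardX]; exact lt_mul_of_one_lt_right Nat.card_pos hNcard) (X ⧸ N)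
    (h.of_surjective (QuotientGroup.mk'_surjective N)) rfl
  set f := QuotientGroup.mk' N
  have hfs : Function.Surjective f := QuotientGroup.mk'_surjective N
  have hker : f.ker = N := QuotientGroup.ker_mk' N
  set C : Subgroup X := Q'.comap f ⊓ verbal p X
  have hCn : C.Normal := inferInstance
  have hrel : N.relIndex C ∣ Nat.card Q' := by
    have h1 := relIndex_ker C f
    rw [hker] at h1
    rw [h1]
    exact card_dvd_of_le (map_le_iff_le_comap.2 inf_le_left)
  have hrelc : Nat.Coprime p (N.relIndex C) := Nat.Coprime.coprime_dvd_right hrel hQc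
  have hCu : ∀ u ∈ verbal p X, ∃ k, u ^ p ^ k ∈ C := by
    intro u hu
    obtain ⟨k, hk⟩ := hQu (f u) (map_mem_verbal hfs hu)
    refine ⟨k, mem_comap.2 ?_, pow_mem hu _⟩
    rwa [map_pow]
  have hcardC : Nat.card (N.subgroupOf C) * N.relIndex C = Nat.card C :=
    (N.subgroupOf C).card_mul_index
  have hdvd : Nat.card (N.subgroupOf C) ∣ Nat.card N :=
    card_comap_dvd_of_injective N C.subtype C.subtype_injective
  by_cases hpN : p ∣ Nat.card N
  · have hNp : Nat.card N = p := by
      have := isPSupersolvable_iff.1 h ⊥ N hN le_rfl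
      rw [relIndex_bot_left] at this
      exact this hpN
    rw [hNp] at hdvd
    have hcen : N.subgroupOf C ≤ center C := by
      intro z hz
      rw [mem_center_iff]
      intro c
      exact Subtype.ext (verbal_commute_of_card_eq hp hNp c.2.2 hz)
    obtain ⟨H, hHc, hH⟩ := exists_subgroup_mem_iff_pow_index_eq_one hcen
      (Nat.Coprime.coprime_dvd_left hdvd hrelc)
    change Nat.card H = N.relIndex C at hHc
    have hmem : ∀ x, x ∈ H.map C.subtype ↔ x ∈ C ∧ x ^ N.relIndex C = 1 := by
      intro x
      constructor
      · rintro ⟨y, hy, rfl⟩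
        exact ⟨y.2, congrArg Subtype.val ((hH y).1 hy)⟩
      · rintro ⟨hx, hx1⟩
        exact ⟨⟨x, hx⟩, (hH _).2 (Subtype.ext hx1), rfl⟩
    refine ⟨H.map C.subtype, ⟨fun x hx g => ?_⟩, ?_, ?_, ?_⟩
    · rw [hmem] at hx ⊢
      refine ⟨hCn.conj_mem _ hx.1 g, ?_⟩
      rw [conj_pow, hx.2, mul_one, mul_inv_cancel]
    · intro x hx
      exact ((hmem x).1 hx).1.2
    · rw [card_map_of_injective C.subtype_injective, hHc]
      exact hrelc
    · intro u hu
      obtain ⟨k, hk⟩ := hCu u hu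
      refine ⟨k + 1, ?_⟩
      rw [pow_succ, pow_mul, hmem]
      refine ⟨pow_mem hk _, ?_⟩
      have h1 : (⟨u ^ p ^ k, hk⟩ : C) ^ N.relIndex C ∈ N.subgroupOf C := pow_index_mem _ _
      have h2 : (u ^ p ^ k) ^ N.relIndex C ∈ N := h1
      have h3 := congrArg Subtype.val (pow_card_eq_one' (x := (⟨_, h2⟩ : N)))
      rw [hNp] at h3
      rw [pow_right_comm]
      exact h3
  · refine ⟨C, hCn, inf_le_right, ?_, hCu⟩
    rw [← hcardC]
    exact Nat.Coprime.mul_right (Nat.Coprime.coprime_dvd_right hdvd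
      ((Nat.Prime.coprime_iff_not_dvd hp).2 hpN)) hrelc

lemma eq_one_of_isPGroup_of_pow_eq_one {D : Subgroup X} (hD : IsPGroup p D) {a : X} (ha : a ∈ D)
    {k : ℕ} (hk : Nat.Coprime p k) (h : a ^ k = 1) : a = 1 := by
  obtain ⟨j, hj⟩ := hD ⟨a, ha⟩
  exact (pow_eq_one_iff_of_coprime (hk.pow_left j)).1 ⟨congrArg Subtype.val hj, h⟩

lemma IsChiefFactor.relIndex_eq_of_isPGroup [Finite X] (hp : p.Prime) {A D : Subgroup X}
    (h : IsPSupersolvable p X) (hAD : IsChiefFactor X A D) (hD : IsPGroup p D) :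
    A.relIndex D = p := by
  have : Fact p.Prime := ⟨hp⟩
  obtain ⟨n, hn⟩ := hD.index (A.subgroupOf D)
  change A.relIndex D = p ^ n at hn
  refine isPSupersolvable_iff.1 h A D hAD bot_le ?_
  rcases n with _ | n
  · rw [pow_zero] at hn
    exact absurd (relIndex_eq_one.1 hn) hAD.2.2.1.not_ge
  · rw [hn, pow_succ]
    exact Dvd.intro_left _ rfl

/-- The `p'`-elements of the verbal subgroup of a `p`-supersolvable group centralize every normal
`p`-subgroup. -/
lemma IsPSupersolvable.commute_of_mem_verbal [Finite X] (hp : p.Prime) (h : IsPSupersolvable p X)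
    {y : X} (hy : y ∈ verbal p X) (hyp : Nat.Coprime p (orderOf y)) (D : Subgroup X)
    (hDn : D.Normal) (hD : IsPGroup p D) : ∀ d ∈ D, Commute y d := by
  induction hn : Nat.card D using Nat.strong_induction_on generalizing D with
  | _ n ih =>
  rcases eq_or_ne D ⊥ with rfl | hne
  · intro d hd
    rw [mem_bot.1 hd]
    exact Commute.one_right y
  obtain ⟨A, -, hAD⟩ := exists_isChiefFactor_le (T := ⊥) (R := D) inferInstance
    (bot_lt_iff_ne_bot.2 hne)
  have hlt := hAD.2.2.1
  have hAn : A.Normal := hAD.1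
  have hcA : ∀ a ∈ A, Commute y a := ih (Nat.card A)
    (by rw [← hn]; exact Set.ncard_lt_ncard hlt) A hAD.1 (hD.to_le hlt.le) rfl
  have hcard : Nat.card (D.map (QuotientGroup.mk' A)) = p := by
    rw [← relIndex_ker, QuotientGroup.ker_mk']
    exact hAD.relIndex_eq_of_isPGroup hp h hD
  have hDmn : (D.map (QuotientGroup.mk' A)).Normal :=
    hDn.map _ (QuotientGroup.mk'_surjective A)
  intro d hd
  have h1 := verbal_commute_of_card_eq hp hcard
    (map_mem_verbal (QuotientGroup.mk'_surjective A) hy) (mem_map_of_mem _ hd)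
  rw [← map_mul, ← map_mul] at h1
  have ha : (d * y)⁻¹ * (y * d) ∈ A := by
    exact QuotientGroup.eq.1 h1.symm
  set a := d⁻¹ * (y * d * y⁻¹) with ha_def
  have haA : a ∈ A := by
    have := hAn.conj_mem _ ha y
    convert this using 1
    rw [ha_def]; group
  have hyda : y * d * y⁻¹ = d * a := by rw [ha_def]; group
  have hpow : ∀ k : ℕ, y ^ k * d * (y ^ k)⁻¹ = d * a ^ k := by
    intro k
    induction k with
    | zero => simp
    | succ k ihk =>
      have e : y ^ (k + 1) * d * (y ^ (k + 1))⁻¹ = y * (y ^ k * d * (y ^ k)⁻¹) * y⁻¹ := by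
        rw [pow_succ']; group
      have e2 : y * (d * a ^ k) * y⁻¹ = (y * d * y⁻¹) * (y * a ^ k * y⁻¹) := by group
      have e3 : y * a ^ k * y⁻¹ = a ^ k := by
        rw [((hcA a haA).pow_right k).eq, mul_inv_cancel_right]
      rw [e, ihk, e2, e3, hyda, mul_assoc, ← pow_succ']
  have h2 := hpow (orderOf y)
  rw [pow_orderOf_eq_one, one_mul, inv_one, mul_one, left_eq_mul] at h2
  have ha1 : a = 1 := eq_one_of_isPGroup_of_pow_eq_one hD (hlt.le haA) hyp h2
  rw [ha1, mul_one] at hyda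
  exact mul_inv_eq_iff_eq_mul.1 hyda

end Verbal

section MinimalNormal

lemma exists_eigenvector_zmod {p : ℕ} [Fact p.Prime] {V : Type*} [AddCommGroup V]
    [Module (ZMod p) V] [Finite V] [Nontrivial V] (f : Module.End (ZMod p) V) (hf : f ^ p = f) :
    ∃ v : V, v ≠ 0 ∧ ∃ a : ℕ, f v = a • v := by
  have hdvd : minpoly (ZMod p) f ∣ Polynomial.X ^ p - Polynomial.X := by
    apply minpoly.dvd
    simp [hf]
  have hspl : (Polynomial.X ^ p - Polynomial.X : Polynomial (ZMod p)).Splits := by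
    have := FiniteField.splits_X_pow_card_sub_X (K := ZMod p) p
    simpa using this
  have hne : (Polynomial.X ^ p - Polynomial.X : Polynomial (ZMod p)) ≠ 0 :=
    FiniteField.X_pow_card_sub_X_ne_zero _ (Fact.out : p.Prime).one_lt
  have : Module.Finite (ZMod p) V := Module.Finite.of_finite
  have hs := Polynomial.Splits.of_dvd hspl hne hdvd
  obtain ⟨μ, hμ⟩ := hs.exists_eval_eq_zero
    (minpoly.degree_pos (Algebra.IsIntegral.isIntegral f)).ne'
  obtain ⟨v, hv⟩ := (Module.End.hasEigenvalue_of_isRoot hμ).exists_hasEigenvector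
  refine ⟨v, hv.2, μ.val, ?_⟩
  rw [hv.apply_eq_smul]
  conv_lhs => rw [← ZMod.natCast_zmod_val μ]
  exact Nat.cast_smul_eq_nsmul _ _ _

lemma AddMonoidHom.exists_eigenvector {p : ℕ} (hp : p.Prime) {V : Type*} [AddCommGroup V] [Finite V]
    [Nontrivial V] (hexp : ∀ v : V, p • v = 0) (f : V →+ V) (hf : ∀ v, f^[p] v = f v) :
    ∃ v : V, v ≠ 0 ∧ ∃ a : ℕ, f v = a • v := by
  have : Fact p.Prime := ⟨hp⟩
  let _ : Module (ZMod p) V := AddCommGroup.zmodModule hexp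
  refine exists_eigenvector_zmod (f.toZModLinearMap p) ?_
  ext v
  rw [Module.End.pow_apply]
  exact hf v

lemma exists_eigenvector {p : ℕ} (hp : p.Prime) {V : Type*} [CommGroup V] [Finite V] [Nontrivial V]
    (hexp : ∀ v : V, v ^ p = 1) (T : MulAut V) (hT : T ^ (p - 1) = 1) :
    ∃ v : V, v ≠ 1 ∧ ∃ a : ℕ, T v = v ^ a := by
  have hiter : ∀ (k : ℕ) (v : V), T^[k] v = (T ^ k) v := by
    intro k
    induction k with
    | zero => intro v; rfl
    | succ k ih =>
      intro v
      rw [Function.iterate_succ_apply, ih, pow_succ, MulAut.mul_apply]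
  refine AddMonoidHom.exists_eigenvector hp (V := Additive V) hexp
    (MonoidHom.toAdditive T.toMonoidHom) fun v => ?_
  have h := hiter p v.toMul
  rw [← Nat.sub_add_cancel hp.one_le, pow_succ, hT, one_mul, Nat.sub_add_cancel hp.one_le] at h
  exact h

lemma card_eq_of_pow_mem_centralizer {X : Type*} [Group X] [Finite X] {p : ℕ} (hp : p.Prime)
    {N : Subgroup X} (hN : IsChiefFactor X ⊥ N) (hNp : IsPGroup p N)
    (hu : ∀ u ∈ verbal p X, ∃ k, ∀ v ∈ N, u ^ p ^ k * v = v * u ^ p ^ k) :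
    Nat.card N = p := by
  have : Fact p.Prime := ⟨hp⟩
  have hNn : N.Normal := hN.2.1
  have hne : N ≠ ⊥ := hN.2.2.1.ne'
  have : Nontrivial N := N.nontrivial_iff_ne_bot.2 hne
  have hmin : ∀ T : Subgroup X, T.Normal → T ≤ N → (∃ x ∈ T, x ≠ 1) → N ≤ T := by
    rintro T hT hTN ⟨x, hx, hx1⟩
    rcases hN.2.2.2 T hT bot_le hTN with h | h
    · rw [h] at hx
      exact absurd (mem_bot.1 hx) hx1
    · exact h.ge
  have hcomm : ∀ a ∈ N, ∀ b ∈ N, a * b = b * a := by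
    have := hNp.center_nontrivial
    obtain ⟨z, hz⟩ := exists_ne (1 : center N)
    have h := hmin (centralizer (N : Set X) ⊓ N) inferInstance inf_le_right
      ⟨z, ⟨mem_centralizer_iff.2 fun b hb =>
        congrArg Subtype.val (mem_center_iff.1 z.2 ⟨b, hb⟩), z.1.2⟩,
        fun h => hz (Subtype.ext (Subtype.ext h))⟩
    exact fun a ha b hb => (mem_centralizer_iff.1 (h hb).1 a ha)
  have hexp : ∀ a ∈ N, a ^ p = 1 := by
    let E : Subgroup X :=
      { carrier := {a | a ∈ N ∧ a ^ p = 1}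
        one_mem' := ⟨N.one_mem, one_pow p⟩
        mul_mem' := fun {a b} ha hb => ⟨mul_mem ha.1 hb.1, by
          rw [(show Commute a b from hcomm a ha.1 b hb.1).mul_pow, ha.2, hb.2, one_mul]⟩
        inv_mem' := fun {a} ha => ⟨inv_mem ha.1, by rw [inv_pow, ha.2, inv_one]⟩ }
    have hE : E.Normal := ⟨fun a ha g => ⟨hNn.conj_mem a ha.1 g, by
      rw [conj_pow, ha.2, mul_one, mul_inv_cancel]⟩⟩
    obtain ⟨n, hn0, hn⟩ := hNp.nontrivial_iff_card.1 ‹_›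
    obtain ⟨a, ha⟩ := exists_prime_orderOf_dvd_card' (G := N) p
      (by rw [hn]; exact dvd_pow_self p hn0.ne')
    have h := hmin E hE (fun a ha => ha.1) ⟨a, ⟨a.2,
        congrArg Subtype.val (show a ^ p = 1 by rw [← ha, pow_orderOf_eq_one])⟩, fun h => by
        rw [show a = 1 from Subtype.ext h, orderOf_one] at ha
        exact hp.one_lt.ne ha⟩
    exact fun a ha => (h ha).2
  have hcen : ∀ u ∈ verbal p X, ∀ v ∈ N, u * v = v * u := by
    let K : Subgroup (MulAut N) := (verbal p X).map MulAut.conjNormal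
    have hK : IsPGroup p K := by
      rintro ⟨_, u, hu', rfl⟩
      obtain ⟨k, hk⟩ := hu u hu'
      refine ⟨k, Subtype.ext ?_⟩
      ext v
      rw [SubmonoidClass.coe_pow, ← map_pow, MulAut.conjNormal_apply, hk v v.2,
        mul_inv_cancel_right]
      rfl
    obtain ⟨n, hn0, hn⟩ := hNp.nontrivial_iff_card.1 ‹_›
    obtain ⟨b, hb, hb1⟩ := hK.exists_fixed_point_of_prime_dvd_card_of_fixed_point N
      (by rw [hn]; exact dvd_pow_self p hn0.ne') (a := 1) (fun φ => map_one φ.1)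
    have h := hmin (centralizer (verbal p X : Set X) ⊓ N) inferInstance inf_le_right
      ⟨b, ⟨mem_centralizer_iff.2 fun u hu' => ?_, b.2⟩, fun h => hb1 (Subtype.ext h.symm)⟩
    · exact fun u hu' v hv => mem_centralizer_iff.1 (h hv).1 u hu'
    · have h1 : ((MulAut.conjNormal u : MulAut N) b : X) = b :=
        congrArg Subtype.val (hb ⟨MulAut.conjNormal u, mem_map_of_mem _ hu'⟩)
      rw [MulAut.conjNormal_apply] at h1
      exact mul_inv_eq_iff_eq_mul.1 h1
  have hscalar : ∀ g : X, ∃ a : ℕ, ∀ v ∈ N, g * v * g⁻¹ = v ^ a := by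
    intro g
    let _ : CommGroup N :=
      { (inferInstance : Group N) with
        mul_comm := fun a b => Subtype.ext (hcomm a a.2 b b.2) }
    obtain ⟨v, hv1, a, hva⟩ := exists_eigenvector hp (V := N)
      (fun v => Subtype.ext (hexp v v.2)) (MulAut.conjNormal g) (by
        ext v
        rw [← map_pow, MulAut.conjNormal_apply,
          hcen (g ^ (p - 1)) (subset_closure (Or.inr ⟨g, rfl⟩)) v v.2, mul_inv_cancel_right]
        rfl)
    refine ⟨a, ?_⟩
    let W : Subgroup X :=
      { carrier := {w | w ∈ N ∧ g * w * g⁻¹ = w ^ a}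
        one_mem' := ⟨N.one_mem, by simp⟩
        mul_mem' := fun {b c} hb hc => ⟨mul_mem hb.1 hc.1, by
          rw [(show Commute b c from hcomm b hb.1 c hc.1).mul_pow, ← hb.2, ← hc.2]
          group⟩
        inv_mem' := fun {b} hb => ⟨inv_mem hb.1, by
          rw [inv_pow, ← hb.2]
          group⟩ }
    have hW : W.Normal := by
      refine ⟨fun w hw x => ⟨hNn.conj_mem w hw.1 x, ?_⟩⟩
      have h1 := hcen (g⁻¹ * x⁻¹ * g * x) (subset_closure (Or.inl ⟨g⁻¹, x⁻¹, by
        rw [commutatorElement_def, inv_inv, inv_inv]⟩)) w hw.1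
      have h2 : g * (x * w * x⁻¹) * g⁻¹ =
          x * (g * (g⁻¹ * x⁻¹ * g * x * w) * (g⁻¹ * x⁻¹ * g * x)⁻¹ * g⁻¹) * x⁻¹ := by group
      rw [h2, h1, conj_pow, ← hw.2]
      group
    have h := hmin W hW (fun w hw => hw.1) ⟨v, ⟨v.2, ?_⟩, fun h => hv1 (Subtype.ext h)⟩
    · exact fun w hw => (h hw).2
    · rw [← MulAut.conjNormal_apply]
      exact congrArg Subtype.val hva
  obtain ⟨v, hv⟩ := exists_ne (1 : N)
  have hv1 : (v : X) ≠ 1 := fun h => hv (Subtype.ext h)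
  have hZ : (zpowers (v : X)).Normal := by
    refine ⟨fun w hw g => ?_⟩
    obtain ⟨a, ha⟩ := hscalar g
    rw [ha w ((zpowers_le.2 v.2) hw)]
    exact pow_mem hw a
  have hle : zpowers (v : X) ≤ N := zpowers_le.2 v.2
  rw [le_antisymm (hmin _ hZ hle ⟨v, mem_zpowers _, hv1⟩) hle, Nat.card_zpowers]
  exact orderOf_eq_prime (hexp v v.2) hv1

end MinimalNormal

section AbelianComplements

open MulOpposite

variable {G : Type*} [Group G] [Finite G]

lemma Subgroup.IsComplement'.eq_of_le {H K L : Subgroup G} (hK : IsComplement' H K)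
    (hL : IsComplement' H L) (h : K ≤ L) : K = L := by
  apply eq_of_le_of_card_ge h
  have h1 := hK.card_mul_card
  rw [← hL.card_mul_card] at h1
  exact (Nat.eq_of_mul_eq_mul_left Nat.card_pos h1).ge

lemma Subgroup.IsComplement'.exists_eq_stabilizer {H K : Subgroup G} [H.Normal] [IsMulCommutative H]
    (hc : Nat.Coprime (Nat.card H) H.index) (hK : IsComplement' H K) :
    ∃ α : H.QuotientDiff, K = MulAction.stabilizer G α := by
  let T : H.LeftTransversal := ⟨(K : Set G), hK.symm⟩
  let α : H.QuotientDiff := Quotient.mk'' T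
  refine ⟨α, hK.eq_of_le (isComplement'_stabilizer_of_coprime hc) fun k hk => ?_⟩
  have hT : op k⁻¹ • T = T := Subtype.ext (op_smul_coe_set (inv_mem hk))
  exact MulAction.mem_stabilizer_iff.2 (congrArg (fun S => (Quotient.mk'' S : H.QuotientDiff)) hT)

/-- Complements of an abelian normal Hall subgroup are conjugate. -/
lemma Subgroup.IsComplement'.exists_smul_eq {H K L : Subgroup G} [H.Normal] [IsMulCommutative H]
    (hc : Nat.Coprime (Nat.card H) H.index) (hK : IsComplement' H K) (hL : IsComplement' H L) :
    ∃ h ∈ H, L = K.map (MulAut.conj h).toMonoidHom := by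
  obtain ⟨α, rfl⟩ := hK.exists_eq_stabilizer hc
  obtain ⟨β, rfl⟩ := hL.exists_eq_stabilizer hc
  obtain ⟨h, rfl⟩ := Subgroup.exists_smul_eq hc α β
  exact ⟨h, h.2, MulAction.stabilizer_smul_eq_stabilizer_map_conj (h : G) α⟩

/-- A noncentral commutator-closed abelian Hall subgroup of a normal subgroup has a proper
supplement. -/
lemma exists_proper_supplement {R Q : Subgroup G} [R.Normal] [Q.Normal] (hRQ : R ≤ Q)
    (hR : ∀ a ∈ R, ∀ b ∈ R, a * b = b * a) (hc : Nat.Coprime (Nat.card R) (R.relIndex Q))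
    (hcomm : ⁅R, Q⁆ = R) (hne : R ≠ ⊥) : ∃ M : Subgroup G, M ≠ ⊤ ∧ M ⊔ R = ⊤ := by
  let R₀ := R.subgroupOf Q
  have hR₀ : IsMulCommutative R₀ :=
    ⟨⟨fun a b => Subtype.ext (Subtype.ext (hR _ a.2 _ b.2))⟩⟩
  have hcard : Nat.card R₀ = Nat.card R := Nat.card_congr (subgroupOfEquivOfLe hRQ).toEquiv
  have hc₀ : Nat.Coprime (Nat.card R₀) R₀.index := by rw [hcard]; exact hc
  obtain ⟨K₀, hK₀⟩ := exists_right_complement'_of_coprime hc₀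
  let K := K₀.map Q.subtype
  have hfrat : ∀ g : G, ∃ r ∈ R, r⁻¹ * g ∈ normalizer (K : Set G) := by
    intro g
    let φ : MulAut Q := MulAut.conjNormal g
    have hcardL : Nat.card (K₀.map φ.toMonoidHom) = Nat.card K₀ :=
      card_map_of_injective φ.injective
    have hmul : Nat.card R₀ * Nat.card K₀ = Nat.card Q := hK₀.card_mul_card
    have hL : IsComplement' R₀ (K₀.map φ.toMonoidHom) :=
      isComplement'_of_coprime (by rw [hcardL, hmul])
        (by rwa [hcardL, ← hK₀.symm.index_eq_card])
    obtain ⟨r, hr, hrK⟩ := hK₀.exists_smul_eq hc₀ hL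
    refine ⟨r, hr, ?_⟩
    have h1 := congrArg (Subgroup.map Q.subtype) hrK
    rw [map_map, map_map] at h1
    have h2 : K.map (MulAut.conj g).toMonoidHom = K.map (MulAut.conj (r : G)).toMonoidHom := by
      rw [map_map, map_map]
      exact h1
    rw [mem_normalizer_iff_map_conj_eq, map_mul]
    change K.map ((MulAut.conj (r : G)⁻¹).toMonoidHom.comp (MulAut.conj g).toMonoidHom) = K
    rw [← map_map, h2, map_map]
    convert K.map_id
    ext x
    simp [mul_assoc]
  refine ⟨normalizer (K : Set G), fun htop => hne ?_, ?_⟩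
  · have hKn : K.Normal := normalizer_eq_top_iff.1 htop
    have hKQ : K ≤ Q := map_subtype_le K₀
    have hdisj : Disjoint R K := by
      rw [disjoint_def]
      intro x hxR hxK
      exact congrArg Subtype.val
        (disjoint_def.1 hK₀.disjoint (x := ⟨x, hKQ hxK⟩) hxR ((mem_map_iff_mem
          Q.subtype_injective).1 hxK))
    have hRK : ⁅R, K⁆ = ⊥ := commutator_eq_bot_of_disjoint hdisj
    rw [← hcomm, commutator_comm, commutator_eq_bot_iff_le_centralizer]
    intro q hq
    obtain ⟨⟨⟨a, ha⟩, ⟨b, hb⟩⟩, hab⟩ := hK₀.2 ⟨q, hq⟩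
    have hab' : (a : G) * b = q := congrArg Subtype.val hab
    rw [← hab']
    refine mul_mem (mem_centralizer_iff.2 fun x hx => hR x hx a ha) ?_
    rw [commutator_comm, commutator_eq_bot_iff_le_centralizer] at hRK
    exact hRK (mem_map_of_mem _ hb)
  · rw [eq_top_iff]
    intro g _
    obtain ⟨r, hr, hg⟩ := hfrat g
    rw [sup_comm]
    have := mul_mem (mem_sup_left (T := normalizer (K : Set G)) hr) (mem_sup_right (S := R) hg)
    rwa [mul_inv_cancel_left] at this

end AbelianComplements

section Transfer

lemma mem_commutator_of_mem_center {X : Type*} [Group X] [Finite X] {H : Subgroup X}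
    (hc : Nat.Coprime (Nat.card H) H.index) (hH : H ≤ commutator X) {d : X} (hd : d ∈ H)
    (hdc : d ∈ center X) : (⟨d, hd⟩ : H) ∈ commutator H := by
  let φ : H →* Abelianization H := Abelianization.of
  have h1 := MonoidHom.transfer_eq_pow φ d fun k g₀ _ => by
    rw [mul_assoc, ← mem_center_iff.1 (pow_mem hdc k) g₀, inv_mul_cancel_left]
  have h2 : MonoidHom.transfer φ d = 1 :=
    Abelianization.commutator_subset_ker _ (hH hd)
  rw [h2] at h1
  have h3 : φ ⟨d, hd⟩ ^ H.index = 1 := by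
    rw [← map_pow]
    exact h1.symm
  have h4 : φ ⟨d, hd⟩ ^ Nat.card H = 1 := by
    rw [← map_pow, pow_card_eq_one', map_one]
  have h5 : φ ⟨d, hd⟩ = 1 := (pow_eq_one_iff_of_coprime hc).1 ⟨h4, h3⟩
  rw [← Abelianization.ker_of]
  exact h5

lemma mem_commutator_of_central {G : Type*} [Group G] [Finite G] {R Q : Subgroup G}
    (hRQ : R ≤ Q) (hc : Nat.Coprime (Nat.card R) (R.relIndex Q)) (hcomm : ⁅R, Q⁆ = R)
    {d : G} (hd : d ∈ R) (hdc : ∀ q ∈ Q, q * d = d * q) : d ∈ ⁅R, R⁆ := by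
  have hR₀ : R.subgroupOf Q ≤ commutator Q := by
    rw [← map_subtype_le_map_subtype, map_subgroupOf_eq_of_le hRQ, map_subtype_commutator]
    conv_lhs => rw [← hcomm]
    exact commutator_mono hRQ le_rfl
  have h := mem_commutator_of_mem_center (H := R.subgroupOf Q) (d := ⟨d, hRQ hd⟩)
    (by rwa [Nat.card_congr (subgroupOfEquivOfLe hRQ).toEquiv]) hR₀ hd
    (mem_center_iff.2 fun q => Subtype.ext (hdc q q.2))
  have h1 := mem_map_of_mem (R.subgroupOf Q).subtype h
  rw [map_subtype_commutator] at h1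
  have h2 := mem_map_of_mem Q.subtype h1
  rwa [map_commutator, map_subgroupOf_eq_of_le hRQ] at h2

end Transfer

section ClassTwo

open scoped commutatorElement

variable {G : Type*} [Group G]

lemma pow_mul_eq_of_commutator_central {a b c : G} (h : b * a = a * b * c) (hb : Commute c b)
    (n : ℕ) : b ^ n * a = a * b ^ n * c ^ n := by
  induction n with
  | zero => simp
  | succ n ih =>
    rw [pow_succ', mul_assoc, ih, ← mul_assoc, ← mul_assoc, h, pow_succ' c,
      mul_assoc (a * b), ((hb.pow_right n)).eq]
    simp only [mul_assoc]

lemma mul_pow_of_commutator_central {a b c : G} (h : b * a = a * b * c) (ha : Commute c a)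
    (hb : Commute c b) (n : ℕ) : (a * b) ^ n = a ^ n * b ^ n * c ^ n.choose 2 := by
  induction n with
  | zero => simp
  | succ n ih =>
    have h1 : Commute (c ^ n.choose 2) (a * b) := (ha.mul_right hb).pow_left _
    have h2 := (hb.pow_left n).eq
    rw [pow_succ, ih, mul_assoc, h1.eq, Nat.choose_succ_succ' n 1, Nat.choose_one_right]
    calc a ^ n * b ^ n * (a * b * c ^ n.choose 2)
        = a ^ n * (b ^ n * a) * b * c ^ n.choose 2 := by simp only [mul_assoc]
      _ = a ^ n * a * b ^ n * (c ^ n * b) * c ^ n.choose 2 := by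
          rw [pow_mul_eq_of_commutator_central h hb]; simp only [mul_assoc]
      _ = _ := by rw [h2, pow_succ a n, pow_succ b n, pow_add]; simp only [mul_assoc]

/-- If `R = ⁅R, Q⁆` has central commutators and `p`-th powers, then its exponent divides every
multiple `n` of `p` for which `p` divides `n.choose 2`. -/
lemma pow_eq_one_of_commutator_eq {R Q : Subgroup G} {p n : ℕ} (hRQ : R ≤ Q)
    (hcomm : ⁅R, Q⁆ = R) [R.Normal]
    (hcen : ∀ a ∈ R, ∀ b ∈ R, ∀ q ∈ Q, Commute ⁅a, b⁆ q) (hpow : ∀ a ∈ R, ∀ q ∈ Q, Commute (a ^ p) q)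
    (hn : p ∣ n) (hn2 : p ∣ n.choose 2) : ∀ a ∈ R, a ^ n = 1 := by
  have hmul : ∀ a ∈ R, ∀ b ∈ R, (a * b) ^ n = a ^ n * b ^ n := by
    intro a ha b hb
    have hc : b * a = a * b * ⁅b⁻¹, a⁻¹⁆ := by rw [commutatorElement_def]; group
    have hca := hcen b⁻¹ (inv_mem hb) a⁻¹ (inv_mem ha) a (hRQ ha)
    have hcb := hcen b⁻¹ (inv_mem hb) a⁻¹ (inv_mem ha) b (hRQ hb)
    have h1 := pow_mul_eq_of_commutator_central hc hcb p
    rw [(hpow b hb a (hRQ ha)).eq, left_eq_mul] at h1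
    obtain ⟨k, hk⟩ := hn2
    rw [mul_pow_of_commutator_central hc hca hcb, hk, pow_mul, h1, one_pow, mul_one]
  have hcn : ∀ a ∈ R, ∀ q ∈ Q, Commute (a ^ n) q := by
    obtain ⟨k, rfl⟩ := hn
    intro a ha q hq
    rw [pow_mul]
    exact (hpow a ha q hq).pow_left k
  let E : Subgroup G :=
    { carrier := {a | a ∈ R ∧ a ^ n = 1}
      one_mem' := ⟨R.one_mem, one_pow n⟩
      mul_mem' := fun {a b} ha hb => ⟨mul_mem ha.1 hb.1, by
        rw [hmul a ha.1 b hb.1, ha.2, hb.2, one_mul]⟩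
      inv_mem' := fun {a} ha => ⟨inv_mem ha.1, by rw [inv_pow, ha.2, inv_one]⟩ }
  have hE : R ≤ E := by
    conv_lhs => rw [← hcomm]
    rw [commutator_le]
    intro a ha q hq
    have hq' : q * a⁻¹ * q⁻¹ ∈ R := (inferInstance : R.Normal).conj_mem _ (inv_mem ha) q
    have h1 : ⁅a, q⁆ = a * (q * a⁻¹ * q⁻¹) := by rw [commutatorElement_def]; group
    rw [h1]
    refine ⟨mul_mem ha hq', ?_⟩
    rw [hmul a ha _ hq', conj_pow, ← (hcn a⁻¹ (inv_mem ha) q hq).eq, mul_inv_cancel_right, inv_pow,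
      mul_inv_cancel]
  exact fun a ha => (hE ha).2

end ClassTwo

section Residual

open scoped commutatorElement

variable {G : Type*} [Group G] {p : ℕ} {R : Subgroup G}

lemma surjective_mk'_comp_subtype {M T : Subgroup G} [T.Normal] (hMT : M ⊔ T = ⊤) :
    Function.Surjective ((QuotientGroup.mk' T).comp M.subtype) := by
  intro x
  obtain ⟨g, rfl⟩ := QuotientGroup.mk'_surjective T x
  obtain ⟨m, hm, t, ht, rfl⟩ := mem_sup_of_normal_right.1 (hMT ▸ mem_top g)
  refine ⟨⟨m, hm⟩, ?_⟩
  have ht1 : QuotientGroup.mk' T t = 1 := (QuotientGroup.eq_one_iff t).2 ht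
  rw [map_mul, ht1, mul_one]
  rfl

/-- `G` is a `p`-solvable minimal non-`p`-supersolvable group with residual `R`, expressed through
chief factors. -/
structure IsMinimalResidual (p : ℕ) (R : Subgroup G) : Prop where
  prime : p.Prime
  solv : IsPSolvable p G
  min : ∀ H : Subgroup G, H < ⊤ → IsPSupersolvable p H
  normal : R.Normal
  good : GoodAbove p R
  le_of_good : ∀ N : Subgroup G, N.Normal → GoodAbove p N → R ≤ N
  ne_bot : R ≠ ⊥

lemma IsPSupersolvableResidual.isMinimalResidual [Finite G] (hp : p.Prime) (hsolv : IsPSolvable p G)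
    (hns : ¬ IsPSupersolvable p G) (hmin : ∀ H : Subgroup G, H < ⊤ → IsPSupersolvable p H)
    (hR : IsPSupersolvableResidual p R) : IsMinimalResidual p R := by
  have hRn := hR.1
  have hg : GoodAbove p R := isPSupersolvable_quotient_iff.1 hR.2.1
  refine ⟨hp, hsolv, hmin, hRn, hg, fun N hN hNg => ?_, fun h => ?_⟩
  · exact hR.2.2 N hN (isPSupersolvable_quotient_iff.2 hNg)
  · rw [h] at hg
    exact hns (isPSupersolvable_iff.2 hg)

namespace IsMinimalResidual

/-- A proper subgroup cannot supplement a normal subgroup that does not contain the residual. -/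
lemma eq_top_of_sup_eq_top [Finite G] (h : IsMinimalResidual p R) {M T : Subgroup G} (hT : T.Normal)
    (hMT : M ⊔ T = ⊤) (hRT : ¬ R ≤ T) : M = ⊤ := by
  by_contra hM
  exact hRT (h.le_of_good T hT (isPSupersolvable_quotient_iff.1
    ((h.min M (lt_top_iff_ne_top.2 hM)).of_surjective
      (surjective_mk'_comp_subtype hMT))))

lemma le_of_isCoatom [Finite G] (h : IsMinimalResidual p R) {M T : Subgroup G} (hM : IsCoatom M)
    (hT : T.Normal) (hRT : ¬ R ≤ T) : T ≤ M := by
  by_contra hTM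
  refine hM.1 (h.eq_top_of_sup_eq_top hT ?_ hRT)
  exact hM.2 _ (lt_of_le_of_ne le_sup_left fun he => hTM (he ▸ le_sup_right))

lemma relIndex_of_isChiefFactor [Finite G] (h : IsMinimalResidual p R) {D : Subgroup G}
    (hD : IsChiefFactor G D R) : D.relIndex R ≠ p ∧ ∃ n, D.relIndex R = p ^ n := by
  have hRn := h.normal
  have key : ¬ (p ∣ D.relIndex R → D.relIndex R = p) := by
    intro hp
    refine hD.2.2.1.not_ge (h.le_of_good D hD.1 (h.good.extend hD.2.2.1.le ?_))
    intro A B hAB hDA hBR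
    rcases hD.2.2.2 A hAB.1 hDA (hAB.2.2.1.le.trans hBR) with rfl | rfl
    · rcases hD.2.2.2 B hAB.2.1 hAB.2.2.1.le hBR with rfl | rfl
      · exact absurd hAB.2.2.1 (lt_irrefl _)
      · exact hp
    · exact absurd hBR hAB.2.2.1.not_ge
  push Not at key
  refine ⟨key.2, ?_⟩
  have h1 := h.solv D R hD
  rw [factorCard_eq_relIndex hD.2.2.1.le] at h1
  exact h1.resolve_right (not_not.2 key.1)

lemma isPGroup [Finite G] (h : IsMinimalResidual p R) : IsPGroup p R := by
  have : Fact p.Prime := ⟨h.prime⟩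
  have hRn := h.normal
  obtain ⟨D, -, hD⟩ := exists_isChiefFactor_le (T := ⊥) (R := R) inferInstance
    (bot_lt_iff_ne_bot.2 h.ne_bot)
  obtain ⟨-, n, hn⟩ := h.relIndex_of_isChiefFactor hD
  have S : Sylow p R := default
  let S' : Subgroup G := S.1.map R.subtype
  have hS'R : S' ≤ R := map_subtype_le _
  have hindex : S'.relIndex R = S.1.index := by
    change (S'.subgroupOf R).index = _
    rw [show S'.subgroupOf R = S.1 from comap_map_eq_self_of_injective R.subtype_injective _]
  have hSD : S' ⊔ D = R := by
    refine le_antisymm (sup_le hS'R hD.2.2.1.le) (relIndex_eq_one.1 ?_)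
    have h1 : (S' ⊔ D).relIndex R ∣ S.1.index := by
      rw [← hindex]
      exact relIndex_dvd_of_le_left R le_sup_left
    have h2 : (S' ⊔ D).relIndex R ∣ p ^ n := by
      rw [← hn]
      exact relIndex_dvd_of_le_left R le_sup_right
    exact Nat.eq_one_of_dvd_coprimes (((Nat.Prime.coprime_iff_not_dvd h.prime).2
      S.not_dvd_index).pow_left n) h2 h1
  have hnorm := Sylow.normalizer_sup_eq_top S
  have hNn : normalizer (S' : Set G) = ⊤ := by
    refine h.eq_top_of_sup_eq_top (T := D) hD.1 ?_ hD.2.2.1.not_ge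
    rw [eq_top_iff, ← hnorm]
    refine sup_le le_sup_left ?_
    rw [← hSD]
    exact sup_le (le_normalizer.trans le_sup_left) le_sup_right
  have hSn : S'.Normal := normalizer_eq_top_iff.1 hNn
  have hgood : GoodAbove p S' := h.good.extend hS'R fun A B hAB hSA hBR hdvd => by
    have h1 : A.relIndex B ∣ S.1.index := by
      rw [← hindex]
      have h2 : A.relIndex B ∣ S'.relIndex B := relIndex_dvd_of_le_left B hSA
      exact h2.trans (Dvd.intro _ (relIndex_mul_relIndex S' B R (hSA.trans hAB.2.2.1.le) hBR))
    exact absurd (hdvd.trans h1) S.not_dvd_index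
  have hRS : R ≤ S' := h.le_of_good S' hSn hgood
  have hS'p : IsPGroup p S' := S.2.map _
  exact hS'p.to_le hRS

lemma commutator_lt [Finite G] (h : IsMinimalResidual p R) : ⁅R, R⁆ < R := by
  have : Fact p.Prime := ⟨h.prime⟩
  have := h.isPGroup.isNilpotent
  have : Nontrivial R := R.nontrivial_iff_ne_bot.2 h.ne_bot
  have h1 := Group.IsSolvable.commutator_lt_top_of_nontrivial R
  rw [← map_subtype_commutator]
  refine lt_of_le_of_ne (map_subtype_le _) fun he => h1.ne ?_
  rw [eq_top_iff]
  intro x _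
  have hx : (x : G) ∈ (_root_.commutator R).map R.subtype := he.ge x.2
  exact (mem_map_iff_mem R.subtype_injective).1 hx

/-- The residual has no central factor under a normal subgroup modulo which the verbal subgroup is
a `p`-group. -/
lemma commutator_eq [Finite G] (h : IsMinimalResidual p R) {Q : Subgroup G} (hQ : Q.Normal)
    (hu : ∀ u ∈ verbal p G, ∃ k, u ^ p ^ k ∈ Q) : ⁅R, Q⁆ = R := by
  have hRn := h.normal
  by_contra hne
  have hlt : ⁅R, Q⁆ < R := lt_of_le_of_ne (commutator_le_left R Q) hne
  obtain ⟨D, hle, hD⟩ := exists_isChiefFactor_le (T := ⁅R, Q⁆) (R := R) inferInstance hlt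
  have hDn := hD.1
  set f := QuotientGroup.mk' D
  have hfs : Function.Surjective f := QuotientGroup.mk'_surjective D
  have hker : f.ker = D := QuotientGroup.ker_mk' D
  have hmap := hD.map hfs hker.le
  have hbot : D.map f = ⊥ := by rw [Subgroup.map_eq_bot_iff, hker]
  rw [hbot] at hmap
  refine (h.relIndex_of_isChiefFactor hD).1 ?_
  have hcard := relIndex_ker R f
  rw [hker] at hcard
  rw [hcard]
  refine card_eq_of_pow_mem_centralizer h.prime hmap (h.isPGroup.map f) ?_
  intro u hu'
  rw [← map_verbal hfs] at hu'
  obtain ⟨u, hu', rfl⟩ := hu'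
  obtain ⟨k, hk⟩ := hu u hu'
  refine ⟨k, ?_⟩
  rintro _ ⟨r, hr, rfl⟩
  have h1 : f ⁅r, u ^ p ^ k⁆ = 1 :=
    (QuotientGroup.eq_one_iff _).2 (hle (commutator_mem_commutator hr hk))
  rw [map_commutatorElement, commutatorElement_eq_one_iff_mul_comm, map_pow] at h1
  exact h1.symm

lemma exists_isCoatom_sup_eq_top [Finite G] (h : IsMinimalResidual p R) {Q : Subgroup G}
    (hQ : Q.Normal) (hRQ : R ≤ Q) (hc : Nat.Coprime p (R.relIndex Q)) (hcomm : ⁅R, Q⁆ = R) :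
    ∃ M : Subgroup G, IsCoatom M ∧ M ⊔ R = ⊤ := by
  have : Fact p.Prime := ⟨h.prime⟩
  have hRn := h.normal
  set f := QuotientGroup.mk' ⁅R, R⁆
  have hfs : Function.Surjective f := QuotientGroup.mk'_surjective _
  have hker : f.ker = ⁅R, R⁆ := QuotientGroup.ker_mk' _
  have hlt := h.commutator_lt
  have hRmn : (R.map f).Normal := hRn.map f hfs
  have hQmn : (Q.map f).Normal := hQ.map f hfs
  have hRR : (R.map f).comap f = R := comap_map_eq_self (hker.le.trans hlt.le)
  have hQQ : (Q.map f).comap f = Q := comap_map_eq_self (hker.le.trans (hlt.le.trans hRQ))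
  obtain ⟨M, hM, hMR⟩ := exists_proper_supplement (R := R.map f) (Q := Q.map f) (map_mono hRQ)
    (by
      rintro _ ⟨a, ha, rfl⟩ _ ⟨b, hb, rfl⟩
      rw [← commutatorElement_eq_one_iff_mul_comm, ← map_commutatorElement]
      exact (QuotientGroup.eq_one_iff _).2 (commutator_mem_commutator ha hb))
    (by
      rw [← relIndex_comap_comap hfs, hRR, hQQ]
      obtain ⟨n, hn⟩ := IsPGroup.iff_card.1 (h.isPGroup.map f)
      rw [hn]
      exact hc.pow_left n)
    (by rw [← map_commutator, hcomm])
    (by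
      rw [Ne, Subgroup.map_eq_bot_iff, hker]
      exact hlt.not_ge)
  have hM' : M.comap f ≠ ⊤ := fun he => hM (by
    rw [← map_comap_eq_self_of_surjective hfs M, he, map_top_of_surjective f hfs])
  have hsup : M.comap f ⊔ R = ⊤ := by
    calc M.comap f ⊔ R = M.comap f ⊔ (R.map f).comap f := by rw [hRR]
      _ = ⊤ := by rw [comap_sup_eq f M (R.map f) hfs, hMR, comap_top]
  obtain ⟨L, hL, hML⟩ := (eq_top_or_exists_le_coatom (M.comap f)).resolve_left hM'
  exact ⟨L, hL, top_le_iff.1 (hsup ▸ sup_le_sup_right hML R)⟩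

lemma exists_eq_mul_of_mem [Finite G] (h : IsMinimalResidual p R) {Q M : Subgroup G}
    (hRQ : R ≤ Q) (hc : Nat.Coprime p (R.relIndex Q)) (hQv : Q ≤ verbal p G ⊔ R)
    (hM : IsCoatom M) (hMR : M ⊔ R = ⊤) {q : G} (hq : q ∈ Q) :
    ∃ y : G, ∃ r ∈ R, q = y * r ∧ ∀ d ∈ M ⊓ R, Commute y d := by
  have : Fact p.Prime := ⟨h.prime⟩
  have hRn := h.normal
  set f := QuotientGroup.mk' R
  have hfs : Function.Surjective f := QuotientGroup.mk'_surjective R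
  have hfM := surjective_mk'_comp_subtype hMR
  have hf1 : ∀ x, f x = 1 ↔ x ∈ R := fun x => QuotientGroup.eq_one_iff x
  obtain ⟨u₀, hu₀, r₀, hr₀, rfl⟩ := mem_sup_of_normal_right.1 (hQv hq)
  have hfu := map_mem_verbal (p := p) hfs hu₀
  rw [← map_verbal hfM] at hfu
  obtain ⟨u, hu, huu₀⟩ := hfu
  change f u = f u₀ at huu₀
  have huQ : (u : G) ∈ Q := by
    have h1 : (u : G)⁻¹ * u₀ ∈ R := by rw [← hf1, map_mul, map_inv, huu₀, inv_mul_cancel]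
    have h2 := (mul_mem_cancel_right (hRQ hr₀)).1 hq
    have h3 := mul_mem h2 (inv_mem (hRQ h1))
    rwa [mul_inv_rev, inv_inv, mul_inv_cancel_left] at h3
  set m := R.relIndex Q with hm
  have hum : (u : G) ^ m ∈ R := by
    have h1 : (⟨u, huQ⟩ : Q) ^ m ∈ R.subgroupOf Q := pow_index_mem _ _
    exact h1
  obtain ⟨e, he⟩ := IsPGroup.iff_card.1 h.isPGroup
  obtain ⟨k, hk1, hk0⟩ := Nat.chineseRemainder (n := m) (m := p ^ e) (hc.pow_left e).symm 1 0
  obtain ⟨j, hj⟩ := (Nat.modEq_zero_iff_dvd.1 hk0)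
  have hym : ((u : G) ^ k) ^ m = 1 := by
    have h1 := congrArg Subtype.val (pow_card_eq_one' (x := (⟨_, hum⟩ : R)))
    change ((u : G) ^ m) ^ Nat.card R = 1 at h1
    rw [pow_right_comm, hj, pow_mul, ← he, h1, one_pow]
  have hfy : f ((u : G) ^ k) = f u₀ := by
    have h1 : orderOf (f u) ∣ m := orderOf_dvd_of_pow_eq_one (by rw [← map_pow, hf1]; exact hum)
    rw [map_pow, ← huu₀, pow_eq_pow_iff_modEq.2 (hk1.of_dvd h1), pow_one]
  have hyo : Nat.Coprime p (orderOf (u ^ k)) := by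
    refine Nat.Coprime.coprime_dvd_right (orderOf_dvd_of_pow_eq_one (Subtype.ext ?_)) hc
    exact hym
  refine ⟨(u : G) ^ k, ((u : G) ^ k)⁻¹ * (u₀ * r₀), ?_, (mul_inv_cancel_left _ _).symm, ?_⟩
  · rw [← hf1, map_mul, map_inv, hfy, map_mul, (hf1 r₀).2 hr₀, mul_one, inv_mul_cancel]
  · intro d hd
    have h1 := (h.min M hM.lt_top).commute_of_mem_verbal h.prime (pow_mem hu k) hyo
      (R.subgroupOf M) inferInstance
      (h.isPGroup.comap_of_injective M.subtype M.subtype_injective) ⟨d, hd.1⟩ hd.2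
    exact congrArg Subtype.val h1

lemma inf_normal [Finite G] (h : IsMinimalResidual p R) {M : Subgroup G}
    (hM : IsCoatom M) (hMR : M ⊔ R = ⊤) : (M ⊓ R).Normal := by
  have hRn := h.normal
  have hle : ⁅R, R⁆ ≤ M ⊓ R :=
    le_inf (h.le_of_isCoatom hM inferInstance h.commutator_lt.not_ge) h.commutator_lt.le
  refine ⟨fun x hx g => ?_⟩
  obtain ⟨m, hm, r, hr, rfl⟩ := mem_sup_of_normal_right.1 (hMR ▸ mem_top g)
  have h1 := mul_mem (hle (commutator_mem_commutator hr hx.2)) hx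
  rw [commutatorElement_def, inv_mul_cancel_right] at h1
  have h2 : m * r * x * (m * r)⁻¹ = m * (r * x * r⁻¹) * m⁻¹ := by group
  rw [h2]
  exact mem_inf.2 ⟨M.mul_mem (M.mul_mem hm h1.1) (M.inv_mem hm), hRn.conj_mem _ h1.2 m⟩

lemma commute_of_mem_inf [Finite G] (h : IsMinimalResidual p R) {Q M : Subgroup G}
    (hRQ : R ≤ Q) (hc : Nat.Coprime p (R.relIndex Q)) (hQv : Q ≤ verbal p G ⊔ R)
    (hcomm : ⁅R, Q⁆ = R) (hM : IsCoatom M) (hMR : M ⊔ R = ⊤) :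
    ∀ d ∈ M ⊓ R, ∀ q ∈ Q, Commute d q := by
  have hRn := h.normal
  have hDn := h.inf_normal hM hMR
  set Z : Subgroup G := centralizer ((M ⊓ R : Subgroup G) : Set G)
  have hZn : Z.Normal := inferInstance
  have hQZ : Q ≤ Z ⊔ R := by
    intro q hq
    obtain ⟨y, r, hr, rfl, hy⟩ := h.exists_eq_mul_of_mem hRQ hc hQv hM hMR hq
    exact mul_mem (mem_sup_left (mem_centralizer_iff.2 fun d hd => (hy d hd).eq.symm))
      (mem_sup_right hr)
  have hRle : R ≤ (R ⊓ Z) ⊔ ⁅R, R⁆ := by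
    calc R = ⁅R, Q⁆ := hcomm.symm
      _ ≤ ⁅R, Z ⊔ R⁆ := commutator_mono le_rfl hQZ
      _ ≤ (R ⊓ Z) ⊔ ⁅R, R⁆ := by
        rw [commutator_le]
        intro r hr x hx
        obtain ⟨z, hz, s, hs, rfl⟩ := mem_sup_of_normal_right.1 hx
        have h1 : ⁅r, z * s⁆ = ⁅r, z⁆ * (z * ⁅r, s⁆ * z⁻¹) := by
          simp only [commutatorElement_def]; group
        rw [h1]
        exact mul_mem (mem_sup_left (commutator_le_inf R Z (commutator_mem_commutator hr hz)))
          (mem_sup_right ((inferInstance : ⁅R, R⁆.Normal).conj_mem _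
            (commutator_mem_commutator hr hs) z))
  have hRZ : R ≤ Z := by
    by_contra hRZ
    refine hM.1 (top_le_iff.1 (hMR ▸ sup_le le_rfl (hRle.trans (sup_le ?_ ?_))))
    · exact h.le_of_isCoatom hM inferInstance fun h1 => hRZ (h1.trans inf_le_right)
    · exact h.le_of_isCoatom hM inferInstance h.commutator_lt.not_ge
  intro d hd q hq
  exact mem_centralizer_iff.1 ((hQZ.trans (sup_le le_rfl hRZ)) hq) d hd

end IsMinimalResidual

/-- A central commutator subgroup lies in the Frattini subgroup. -/
lemma commutator_le_frattini_of_commutator_eq {X : Type*} [Group X] {D : Subgroup X}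
    (hD : D ≤ center X) (hX : commutator X = D) : commutator X ≤ frattini X := by
  rw [frattini, Order.radical]
  refine le_iInf₂ fun J hJ => ?_
  by_contra hle
  rw [hX] at hle
  have hDn : D.Normal := hX ▸ inferInstance
  have hsup : J ⊔ D = ⊤ :=
    hJ.2 _ (lt_of_le_of_ne le_sup_left fun he => hle (he ▸ le_sup_right))
  refine hle (hX ▸ ?_)
  rw [_root_.commutator_def, commutator_le]
  intro a _ b _
  obtain ⟨x, hx, c, hc, rfl⟩ := mem_sup_of_normal_right.1 (hsup ▸ mem_top a)
  obtain ⟨y, hy, d, hd, rfl⟩ := mem_sup_of_normal_right.1 (hsup ▸ mem_top b)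
  have hc' : ∀ z, Commute c z := fun z => (mem_center_iff.1 (hD hc) z).symm
  have hd' : ∀ z, Commute d z := fun z => (mem_center_iff.1 (hD hd) z).symm
  have h1 : ⁅x * c, y * d⁆ = ⁅x, y⁆ := by
    simp only [commutatorElement_def, mul_inv_rev]
    calc x * c * (y * d) * (c⁻¹ * x⁻¹) * (d⁻¹ * y⁻¹)
        = x * (c * (y * d) * c⁻¹) * x⁻¹ * d⁻¹ * y⁻¹ := by group
      _ = x * y * (d * x⁻¹ * d⁻¹) * y⁻¹ := by rw [(hc' (y * d)).eq]; group
      _ = x * y * x⁻¹ * y⁻¹ := by rw [(hd' x⁻¹).eq]; group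
  rw [h1]
  exact mul_mem (mul_mem (mul_mem hx hy) (inv_mem hx)) (inv_mem hy)

namespace IsMinimalResidual

lemma exists_normal_above [Finite G] (h : IsMinimalResidual p R) :
    ∃ Q : Subgroup G, Q.Normal ∧ R ≤ Q ∧ Nat.Coprime p (R.relIndex Q) ∧ Q ≤ verbal p G ⊔ R ∧
      ⁅R, Q⁆ = R := by
  have hRn := h.normal
  obtain ⟨Q, hQn, hQv, hQc, hQu⟩ := IsPSupersolvable.exists_normal_complement_verbal h.prime (G ⧸ R)
    (isPSupersolvable_quotient_iff.2 h.good)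
  set f := QuotientGroup.mk' R
  have hfs : Function.Surjective f := QuotientGroup.mk'_surjective R
  have hker : f.ker = R := QuotientGroup.ker_mk' R
  refine ⟨Q.comap f, hQn.comap f, ?_, ?_, ?_, ?_⟩
  · exact hker.ge.trans (ker_le_comap f Q)
  · have h1 := relIndex_ker (Q.comap f) f
    rw [hker, map_comap_eq_self_of_surjective hfs] at h1
    rwa [h1]
  · rw [← map_verbal hfs] at hQv
    have h1 := comap_mono (f := f) hQv
    rwa [comap_map_eq, hker] at h1
  · refine h.commutator_eq (hQn.comap f) fun u hu => ?_
    obtain ⟨k, hk⟩ := hQu (f u) (map_mem_verbal hfs hu)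
    exact ⟨k, by rwa [mem_comap, map_pow]⟩

/-- The derived subgroup of the residual is central, equal to the Frattini subgroup, and the
quotient by it is a chief factor. -/
lemma structure_of_residual [Finite G] (h : IsMinimalResidual p R) :
    ∃ Q : Subgroup G, R ≤ Q ∧ ⁅R, Q⁆ = R ∧ (∀ d ∈ ⁅R, R⁆, ∀ q ∈ Q, Commute d q) ∧
      (frattini R).map R.subtype = ⁅R, R⁆ ∧ IsChiefFactor G ⁅R, R⁆ R := by
  have hRn := h.normal
  obtain ⟨Q, hQ, hRQ, hc, hQv, hcomm⟩ := h.exists_normal_above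
  obtain ⟨M, hM, hMR⟩ := h.exists_isCoatom_sup_eq_top hQ hRQ hc hcomm
  have hcen := h.commute_of_mem_inf hRQ hc hQv hcomm hM hMR
  have hRM : ¬ R ≤ M := fun hle => hM.1 (by rw [← hMR, sup_eq_left.2 hle])
  have hDle : M ⊓ R ≤ ⁅R, R⁆ := by
    intro d hd
    have : Fact p.Prime := ⟨h.prime⟩
    obtain ⟨e, he⟩ := IsPGroup.iff_card.1 h.isPGroup
    refine mem_commutator_of_central hRQ (by rw [he]; exact hc.pow_left e) hcomm hd.2 ?_
    exact fun q hq => (hcen d hd q hq).eq.symm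
  have hmax : ∀ T : Subgroup G, T.Normal → T ≤ R → T ≠ R → T ≤ ⁅R, R⁆ := fun T hT hTR hne =>
    (le_inf (h.le_of_isCoatom hM hT fun hle => hne (le_antisymm hTR hle)) hTR).trans hDle
  have hlt := h.commutator_lt
  have hle : ⁅R, R⁆ ≤ M ⊓ R := le_inf (h.le_of_isCoatom hM inferInstance hlt.not_ge) hlt.le
  refine ⟨Q, hRQ, hcomm, fun d hd => hcen d (hle hd), ?_, inferInstance, hRn, hlt, ?_⟩
  · apply le_antisymm
    · refine hmax _ inferInstance (map_subtype_le _) fun he => ?_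
      have htop : frattini R = ⊤ := by
        rw [eq_top_iff]
        exact fun x _ => (mem_map_iff_mem R.subtype_injective).1 (he.ge x.2)
      have hnt : Nontrivial R := R.nontrivial_iff_ne_bot.2 h.ne_bot
      obtain ⟨J, hJ, -⟩ := (eq_top_or_exists_le_coatom (⊥ : Subgroup R)).resolve_left bot_ne_top
      exact hJ.1 (top_le_iff.1 (htop ▸ frattini_le_coatom hJ))
    · rw [← map_subtype_commutator]
      refine map_mono (commutator_le_frattini_of_commutator_eq (D := _root_.commutator R) ?_ rfl)
      intro d hd
      have hd' : (d : G) ∈ ⁅R, R⁆ := by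
        rw [← map_subtype_commutator]
        exact mem_map_of_mem _ hd
      exact mem_center_iff.2 fun x =>
        Subtype.ext (hcen d (hle hd') x (hRQ x.2)).eq.symm
  · intro T hT hDT hTR
    by_cases hne : T = R
    · exact Or.inr hne
    · exact Or.inl (le_antisymm (hmax T hT hTR hne) hDT)

lemma pow_mem_commutator [Finite G] (h : IsMinimalResidual p R) (hchief : IsChiefFactor G ⁅R, R⁆ R) :
    ∀ x ∈ R, x ^ p ∈ ⁅R, R⁆ := by
  have hRn := h.normal
  set f := QuotientGroup.mk' ⁅R, R⁆
  have hf1 : ∀ x, f x = 1 ↔ x ∈ ⁅R, R⁆ := fun x => QuotientGroup.eq_one_iff x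
  let T : Subgroup G :=
    { carrier := {x | x ∈ R ∧ f x ^ p = 1}
      one_mem' := ⟨R.one_mem, by rw [map_one, one_pow]⟩
      mul_mem' := fun {a b} ha hb => ⟨mul_mem ha.1 hb.1, by
        have hab : Commute (f a) (f b) := by
          rw [commute_iff_eq, ← commutatorElement_eq_one_iff_mul_comm, ← map_commutatorElement, hf1]
          exact commutator_mem_commutator ha.1 hb.1
        rw [map_mul, hab.mul_pow, ha.2, hb.2, one_mul]⟩
      inv_mem' := fun {a} ha => ⟨inv_mem ha.1, by rw [map_inv, inv_pow, ha.2, inv_one]⟩ }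
  have hT : T.Normal := ⟨fun x hx g => ⟨hRn.conj_mem x hx.1 g, by
    rw [map_mul, map_mul, map_inv, conj_pow, hx.2, mul_one, mul_inv_cancel]⟩⟩
  have hDT : ⁅R, R⁆ ≤ T := fun x hx => ⟨hchief.2.2.1.le hx, by rw [(hf1 x).2 hx, one_pow]⟩
  rcases hchief.2.2.2 T hT hDT (fun x hx => hx.1) with he | he
  · exfalso
    obtain ⟨x, hxR, hxD⟩ := SetLike.exists_of_lt hchief.2.2.1
    obtain ⟨k, hk⟩ := h.isPGroup ⟨x, hxR⟩
    have hk' : x ^ p ^ k = 1 := congrArg Subtype.val hk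
    have key : ∀ j, x ^ p ^ j ∈ ⁅R, R⁆ → x ∈ ⁅R, R⁆ := by
      intro j
      induction j with
      | zero => intro hj; rwa [pow_zero, pow_one] at hj
      | succ j ih =>
        intro hj
        apply ih
        rw [← he]
        refine ⟨pow_mem hxR _, ?_⟩
        rwa [← map_pow, hf1, ← pow_mul, ← pow_succ]
    exact hxD (key k (hk' ▸ one_mem _))
  · intro x hx
    rw [← he] at hx
    rw [← hf1, map_pow]
    exact hx.2

end IsMinimalResidual

end Residual

/-- Lemma 3: structure of `G^{𝔘_p}` for a p-solvable minimal
non-p-supersolvable group `G`. -/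
theorem stmt17 (p : ℕ) (hp : p.Prime) (G : Type*) [Group G] [Finite G]
    (hsolv : IsPSolvable p G) (hns : ¬ IsPSupersolvable p G)
    (hmin : ∀ H : Subgroup G, H < ⊤ → IsPSupersolvable p H)
    (R : Subgroup G) (hR : IsPSupersolvableResidual p R) :
    IsPGroup p R ∧ (p ≠ 2 → Monoid.exponent R = p) ∧ (p = 2 → Monoid.exponent R ≤ 4) ∧
    IsChiefFactor G ((frattini R).map R.subtype) R := by
  have h := hR.isMinimalResidual hp hsolv hns hmin
  have hRn := h.normal
  obtain ⟨Q, hRQ, hcomm, hcen, hfrat, hchief⟩ := h.structure_of_residual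
  have hpow : ∀ n, p ∣ n → p ∣ n.choose 2 → Monoid.exponent R ∣ n := by
    intro n hn hn2
    refine Monoid.exponent_dvd_of_forall_pow_eq_one fun x => Subtype.ext ?_
    exact pow_eq_one_of_commutator_eq hRQ hcomm
      (fun a ha b hb => hcen _ (commutator_mem_commutator ha hb))
      (fun a ha => hcen _ (h.pow_mem_commutator hchief a ha)) hn hn2 x x.2
  refine ⟨h.isPGroup, fun h2 => ?_, fun h2 => ?_, hfrat ▸ hchief⟩
  · have h2' : 2 < p := lt_of_le_of_ne hp.two_le (Ne.symm h2)
    refine ((Nat.dvd_prime hp).1 (hpow p dvd_rfl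
      (hp.dvd_choose_self two_ne_zero h2'))).resolve_left fun h1 => h.ne_bot ?_
    rw [Monoid.exp_eq_one_iff] at h1
    exact R.eq_bot_of_subsingleton
  · subst h2
    exact Nat.le_of_dvd (by norm_num) (hpow 4 (by norm_num) (by decide))
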